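/- Let T be a finite abelian group and β : T × T → {±1} a nondegenerate alternating bicharacter with values in {±1} (β = β̄). Then for a division grading of type (2-f) on the real algebra M_n(C) with support T and commutation bicharacter β, the stabilizer of the grading is isomorphic to T × Z_2, arising as the direct product of Hom(T, {±1}) ≅ T (stabilizer of a real form M_n(R) of the grading) and Aut(C) ≅ Z_2. -/

import Mathlib

theorem exists_quad {T : Type*} [AddCommGroup T] [Fintype T] (h2 : ∀ t : T, t + t = 0)
    (β : T → T → ℝˣ)
    (hβ₁ : ∀ u v w : T, β (u + v) w = β u w * β v w)
    (hβ₂ : ∀ u v w : T, β u (v + w) = β u v * β u w)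
    (hβalt : ∀ u : T, β u u = 1) (hpm : ∀ u v, β u v = 1 ∨ β u v = -1) :
    ∃ μ : T → ℝ, (∀ t, μ t = 1 ∨ μ t = -1) ∧ ∀ u v, μ (u + v) = μ u * μ v * (β u v : ℝ) := by
  classical
  let : Module (ZMod 2) T := AddCommGroup.zmodModule (n := 2) (fun x => by
    rw [two_nsmul]; exact h2 x)
  have hne : (1 : ℝˣ) ≠ -1 := by
    intro h
    have := congrArg Units.val h
    norm_num at this
  have h11 : (1 : ZMod 2) + 1 = 0 := by decide
  let B0 : T → T → ZMod 2 := fun u v => if β u v = 1 then 0 else 1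
  have hB1 : ∀ u v w, B0 (u + v) w = B0 u w + B0 v w := by
    intro u v w
    simp only [B0, hβ₁]
    rcases hpm u w with h | h <;> rcases hpm v w with h' | h' <;> simp [h, h', hne.symm, h11]
  have hB2 : ∀ u v w, B0 u (v + w) = B0 u v + B0 u w := by
    intro u v w
    simp only [B0, hβ₂]
    rcases hpm u w with h | h <;> rcases hpm u v with h' | h' <;> simp [h, h', hne.symm, h11]
  have hB0 : ∀ u, B0 u u = 0 := by intro u; simp [B0, hβalt]
  let B : T →ₗ[ZMod 2] T →ₗ[ZMod 2] ZMod 2 :=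
    AddMonoidHom.toZModLinearMap 2
      { toFun := fun u => AddMonoidHom.toZModLinearMap 2
          { toFun := B0 u
            map_zero' := by have := hB2 u 0 0; simpa using this
            map_add' := hB2 u }
        map_zero' := by
          ext v
          have := hB1 0 0 v
          simpa using this
        map_add' := fun u v => by
          ext w
          exact hB1 u v w }
  have hB : ∀ u v, B u v = B0 u v := fun u v => rfl
  have hsymm : ∀ u v, B0 u v = B0 v u := by
    intro u v
    have := hB0 (u + v)
    rw [hB1, hB2, hB2, hB0, hB0] at this
    have h3 : B0 u v + B0 v u = 0 := by simpa using this
    revert h3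
    generalize B0 u v = a
    generalize B0 v u = b
    revert a b
    decide
  let b := Module.finBasis (ZMod 2) T
  let q : T → ZMod 2 := fun u => ∑ i, ∑ j, if i < j then b.repr u i * b.repr u j * B0 (b i) (b j) else 0
  have hq : ∀ u v, q (u + v) = q u + q v + B0 u v := by
    intro u v
    have e1 : B0 u v = ∑ i, ∑ j, b.repr u i * b.repr v j * B0 (b i) (b j) := by
      rw [← hB]
      conv_lhs => rw [← b.sum_repr u, ← b.sum_repr v]
      simp only [map_sum, map_smul, LinearMap.sum_apply, LinearMap.smul_apply, hB, smul_eq_mul,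
        Finset.mul_sum]
      rw [Finset.sum_comm]
      refine Finset.sum_congr rfl fun i _ => Finset.sum_congr rfl fun j _ => by ring
    have e2 : B0 u v = (∑ i, ∑ j, if i < j then b.repr u i * b.repr v j * B0 (b i) (b j) else 0)
       + ∑ i, ∑ j, if i < j then b.repr v i * b.repr u j * B0 (b i) (b j) else 0 := by
      rw [e1]
      conv_rhs => rw [add_comm, Finset.sum_comm]
      rw [← Finset.sum_add_distrib]
      refine Finset.sum_congr rfl fun i _ => ?_
      rw [← Finset.sum_add_distrib]
      refine Finset.sum_congr rfl fun j _ => ?_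
      rcases lt_trichotomy i j with h | h | h
      · simp [h, h.not_gt]
      · subst h; simp [hB0]
      · rw [if_pos h, if_neg h.not_gt, hsymm (b i) (b j)]; ring
    rw [e2]
    simp only [q, ← Finset.sum_add_distrib]
    refine Finset.sum_congr rfl fun i _ => Finset.sum_congr rfl fun j _ => ?_
    split_ifs
    · simp; ring
    · simp
  refine ⟨fun t => if q t = 0 then 1 else -1, fun t => by dsimp only; split_ifs <;> simp, ?_⟩
  intro u v
  have key := hq u v
  have hz : ∀ x : ZMod 2, x = 0 ∨ x = 1 := by decide
  simp only [key]
  rcases hpm u v with h | h <;> rcases hz (q u) with h1 | h1 <;> rcases hz (q v) with h3 | h3 <;>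
    simp [B0, h, h1, h3, hne.symm, h11]

theorem dual_equiv {T : Type*} [AddCommGroup T] [Fintype T] 
    (β : T → T → ℝˣ)
    (hβ₁ : ∀ u v w : T, β (u + v) w = β u w * β v w)
    (hβ₂ : ∀ u v w : T, β u (v + w) = β u v * β u w)
    (hβnondeg : ∀ t : T, (∀ u : T, β u t = 1) → t = 0) :
    Nonempty ((T →+ Additive ℝˣ) ≃+ T) := by
  classical
  let f : T →+ (T →+ Additive ℝˣ) := AddMonoidHom.mk' (fun t => AddMonoidHom.mk' (fun u => Additive.ofMul (β u t))
    (fun u v => by rw [hβ₁]; rfl)) (fun u v => by ext w; simp [hβ₂])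
  have hinj : Function.Injective f := by
    rw [injective_iff_map_eq_zero]
    intro t ht
    apply hβnondeg
    intro u
    have := DFunLike.congr_fun ht u
    exact this
  let g : (T →+ Additive ℝˣ) → (Multiplicative T →* ℝ) := fun χ =>
    (Units.coeHom ℝ).comp (AddMonoidHom.toMultiplicativeLeft χ)
  have hg : Function.Injective g := by
    intro χ χ' h
    ext t
    exact DFunLike.congr_fun h (Multiplicative.ofAdd t)
  have hli := (linearIndependent_monoidHom (Multiplicative T) ℝ).comp g hg
  have : Finite (T →+ Additive ℝˣ) := hli.finite
  have := Fintype.ofFinite (T →+ Additive ℝˣ)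
  have hc := hli.fintype_card_le_finrank
  simp only [Module.finrank_fintype_fun_eq_card] at hc
  have hbij : Function.Bijective f := by
    rw [Fintype.bijective_iff_injective_and_card]
    refine ⟨hinj, le_antisymm (Fintype.card_le_of_injective f hinj) (hc.trans_eq ?_)⟩
    exact Fintype.card_multiplicative T
  exact ⟨(AddEquiv.ofBijective f hbij).symm⟩

theorem aut_C : Nonempty ((ℂ ≃ₐ[ℝ] ℂ) ≃* Multiplicative (ZMod 2)) := by
  have : Fact (Nat.Prime 2) := ⟨Nat.prime_two⟩
  have h1 : Nat.card (ℂ ≃ₐ[ℝ] ℂ) = 2 := by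
    rw [Nat.card_eq_two_iff]
    refine ⟨1, Complex.conjAe, ?_, ?_⟩
    · intro h
      have := congrArg (fun f : ℂ ≃ₐ[ℝ] ℂ => (f Complex.I).im) h
      norm_num at this
    · ext f
      simp only [Set.mem_insert_iff, Set.mem_singleton_iff, Set.mem_univ, iff_true]
      rcases Complex.real_algHom_eq_id_or_conj (f : ℂ →ₐ[ℝ] ℂ) with h | h
      · left; ext x; exact DFunLike.congr_fun h x
      · right; ext x; exact DFunLike.congr_fun h x
  exact ⟨mulEquivOfPrimeCardEq h1 (by simp)⟩

theorem basis_ind {T A : Type*} [Fintype T] [hT : Nonempty T] [Ring A] [Algebra ℂ A] (b : Module.Basis T ℂ A)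
    (P : A → Prop) (h1 : ∀ (z : ℂ) t, P (z • b t)) (h2 : ∀ x y, P x → P y → P (x + y))
    (x : A) : P x := by
  classical
  have h0 : P 0 := by
    obtain ⟨t⟩ := hT
    simpa using h1 0 t
  rw [← b.sum_repr x]
  exact Finset.sum_induction _ P h2 h0 fun t _ => h1 _ t

theorem exists_F {T A : Type*} [AddCommGroup T] [Fintype T] [Ring A] [Algebra ℂ A] [Algebra ℝ A]
    (hal : ∀ r : ℝ, algebraMap ℝ A r = algebraMap ℂ A (r : ℂ)) (b : Module.Basis T ℂ A) (c : T → T → ℝ) (e : ℝ)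
    (hc : ∀ u v, b u * b v = (c u v : ℂ) • b (u + v)) (he : (1 : A) = (e : ℂ) • b 0)
    (χ : T →+ Additive ℝˣ) (σ : ℂ ≃ₐ[ℝ] ℂ) :
    ∃ F : A →ₐ[ℝ] A, ∀ (z : ℂ) (t : T),
      F (z • b t) = ((((χ t).toMul : ℝˣ) : ℝ) : ℂ) • σ z • b t := by
  classical
  have hσ : ∀ r : ℝ, σ (r : ℂ) = r := fun r => σ.commutes r
  let F0 : A →+ A :=
    { toFun := fun M => ∑ t, ((((χ t).toMul : ℝˣ) : ℝ) : ℂ) • σ (b.repr M t) • b t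
      map_add' := fun x y => by
        simp [add_smul, smul_add, Finset.sum_add_distrib]
      map_zero' := by simp }
  have hF0 : ∀ (z : ℂ) (t : T),
      F0 (z • b t) = ((((χ t).toMul : ℝˣ) : ℝ) : ℂ) • σ z • b t := by
    intro z t
    change ∑ s, ((((χ s).toMul : ℝˣ) : ℝ) : ℂ) • σ (b.repr (z • b t) s) • b s = _
    rw [Finset.sum_eq_single t]
    · simp
    · intro s _ hs
      simp [Finsupp.single_apply, hs.symm]
    · simp
  have hmul : ∀ x y, F0 (x * y) = F0 x * F0 y := by
    intro x y
    induction x using basis_ind b with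
    | h2 x x' h h' => rw [add_mul, map_add, h, h', map_add, add_mul]
    | h1 z t =>
      induction y using basis_ind b with
      | h2 x x' h h' => rw [mul_add, map_add, h, h', map_add, mul_add]
      | h1 w s =>
        have : z • b t * w • b s = (z * w * (c t s : ℂ)) • b (t + s) := by
          rw [smul_mul_smul_comm, hc, smul_smul]
        rw [this, hF0, hF0, hF0]
        simp only [smul_smul, smul_mul_smul_comm, hc, map_add, toMul_add, map_mul, hσ]
        congr 1
        push_cast
        ring
  have hcom : ∀ r : ℝ, F0 (algebraMap ℝ A r) = algebraMap ℝ A r := by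
    intro r
    rw [hal, Algebra.algebraMap_eq_smul_one, he, smul_smul, hF0]
    simp [hσ]
  exact ⟨{ toFun := F0
           map_one' := by simpa using hcom 1
           map_mul' := hmul
           map_zero' := F0.map_zero
           map_add' := F0.map_add
           commutes' := hcom }, hF0⟩

theorem exists_Phi {T A : Type*} [AddCommGroup T] [Fintype T] [Ring A] [Algebra ℂ A] [Algebra ℝ A]
    (hal : ∀ r : ℝ, algebraMap ℝ A r = algebraMap ℂ A (r : ℂ)) (b : Module.Basis T ℂ A) (c : T → T → ℝ) (e : ℝ)
    (hc : ∀ u v, b u * b v = (c u v : ℂ) • b (u + v)) (he : (1 : A) = (e : ℂ) • b 0) :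
    ∃ Φ : (T →+ Additive ℝˣ) → (ℂ ≃ₐ[ℝ] ℂ) → (A ≃ₐ[ℝ] A), ∀ χ σ (z : ℂ) (t : T),
      Φ χ σ (z • b t) = ((((χ t).toMul : ℝˣ) : ℝ) : ℂ) • σ z • b t := by
  choose F hF using exists_F hal b c e hc he
  have hσ : ∀ (σ : ℂ ≃ₐ[ℝ] ℂ) (r : ℝ), σ (r : ℂ) = r := fun σ r => σ.commutes r
  refine ⟨fun χ σ => AlgEquiv.ofAlgHom (F χ σ) (F (-χ) σ⁻¹) ?_ ?_, fun χ σ z t => hF χ σ z t⟩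
  · ext x
    induction x using basis_ind b with
    | h2 x x' h h' => rw [map_add, h, h', map_add]
    | h1 z t => 
      simp only [AlgHom.comp_apply, smul_smul, AlgHom.id_apply, hF, map_mul, hσ, ← mul_assoc]
      simp
  · ext x
    induction x using basis_ind b with
    | h2 x x' h h' => rw [map_add, h, h', map_add]
    | h1 z t => 
      simp only [AlgHom.comp_apply, smul_smul, AlgHom.id_apply, hF, map_mul, hσ, ← mul_assoc]
      simp

theorem exists_X
    {T : Type*} [AddCommGroup T] [Fintype T] (n : ℕ)
    (β : T → T → ℝˣ) (h2 : ∀ t : T, t + t = 0)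
    (𝒟 : T → Submodule ℝ (Matrix (Fin n) (Fin n) ℂ))
    (hmul : ∀ u v : T, ∀ x ∈ 𝒟 u, ∀ y ∈ 𝒟 v, x * y ∈ 𝒟 (u + v))
    (hindep : iSupIndep 𝒟) (htop : (⨆ t, 𝒟 t) = ⊤)
    (hsupp : ∀ t : T, 𝒟 t ≠ ⊥)
    (hcenter : (𝒟 0 : Set (Matrix (Fin n) (Fin n) ℂ)) =
      Set.center (Matrix (Fin n) (Fin n) ℂ))
    (hcomm : ∀ u v : T, ∀ X ∈ 𝒟 u, ∀ Y ∈ 𝒟 v,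
      X * Y = ((β u v : ℝ)) • (Y * X))
    (μ : T → ℝ) (hμ1 : ∀ t, μ t = 1 ∨ μ t = -1)
    (hμ : ∀ u v, μ (u + v) = μ u * μ v * (β u v : ℝ)) :
    ∃ b : Module.Basis T ℂ (Matrix (Fin n) (Fin n) ℂ), ∃ c : T → T → ℝ,
      (∀ t x, x ∈ 𝒟 t ↔ ∃ z : ℂ, x = z • b t) ∧
      (∀ t, b t * b t = (μ t : ℂ) • 1) ∧
      (∀ u v, b u * b v = (c u v : ℂ) • b (u + v)) ∧ (∀ u v, c u v = 1 ∨ c u v = -1) := by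
  classical
  have hsm : ∀ (r : ℝ) (a : Matrix (Fin n) (Fin n) ℂ), r • a = (r : ℂ) • a := fun r a => by
    rw [← smul_one_smul ℂ r a]; simp
  have h0 : ∀ x, x ∈ 𝒟 0 ↔ ∃ z : ℂ, x = z • (1 : Matrix (Fin n) (Fin n) ℂ) := by
    intro x
    rw [← SetLike.mem_coe, hcenter, Matrix.center_eq_range]
    simp only [Set.mem_range, Matrix.scalar_apply, ← Matrix.smul_one_eq_diagonal, eq_comm]
  have hCs : ∀ t, ∀ x ∈ 𝒟 t, ∀ z : ℂ, z • x ∈ 𝒟 t := by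
    intro t x hx z
    have := hmul 0 t _ ((h0 _).2 ⟨z, rfl⟩) x hx
    simpa using this
  have hμ0 : ∀ t, (μ t : ℂ) ≠ 0 := by
    intro t; rcases hμ1 t with h | h <;> simp [h]
  have hinv : ∀ t, ∀ x ∈ 𝒟 t, x ≠ 0 → IsUnit x := by
    intro t x hx hx0
    rw [Matrix.isUnit_iff_isUnit_det, isUnit_iff_ne_zero]
    intro hdet
    obtain ⟨v, hv0, hv⟩ := Matrix.exists_mulVec_eq_zero_iff.2 hdet
    have key : ∀ M : Matrix (Fin n) (Fin n) ℂ, x.mulVec (M.mulVec v) = 0 := by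
      intro M
      have hM : M ∈ ⨆ t, 𝒟 t := by rw [htop]; trivial
      refine Submodule.iSup_induction 𝒟
        (motive := fun M => x.mulVec (M.mulVec v) = 0) hM ?_ ?_ ?_
      · intro s y hy
        rw [Matrix.mulVec_mulVec, hcomm t s x hx y hy, hsm, Matrix.smul_mulVec,
          ← Matrix.mulVec_mulVec, hv]
        simp
      · simp
      · intro a b ha hb
        rw [Matrix.add_mulVec, Matrix.mulVec_add, ha, hb, add_zero]
    apply hx0
    obtain ⟨i, hi⟩ : ∃ i, v i ≠ 0 := by
      by_contra! h
      exact hv0 (funext h)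
    ext k j
    have := congrFun (key (Matrix.single j i (v i)⁻¹)) k
    rw [Matrix.single_mulVec, inv_mul_cancel₀ hi] at this
    change x.mulVec (Pi.single j 1) k = 0 at this
    simpa [Matrix.mulVec_single] using this
  have hn : Nontrivial (Matrix (Fin n) (Fin n) ℂ) := by
    obtain ⟨x, hx, hx0⟩ := (Submodule.ne_bot_iff _).1 (hsupp 0)
    exact ⟨x, 0, hx0⟩
  have hX : ∀ t, ∃ X ∈ 𝒟 t, X * X = (μ t : ℂ) • (1 : Matrix (Fin n) (Fin n) ℂ) := by
    intro t
    obtain ⟨x, hx, hx0⟩ := (Submodule.ne_bot_iff _).1 (hsupp t)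
    have hxx := hmul t t x hx x hx
    rw [h2, h0] at hxx
    obtain ⟨s, hs⟩ := hxx
    have hs0 : s ≠ 0 := by
      rintro rfl
      have hu := (hinv t x hx hx0)
      have := hu.mul hu
      rw [hs, zero_smul] at this
      exact not_isUnit_zero this
    obtain ⟨r, hr⟩ := IsAlgClosed.exists_eq_mul_self ((μ t : ℂ) / s)
    refine ⟨r • x, hCs t x hx r, ?_⟩
    rw [smul_mul_smul_comm, ← hr, hs, smul_smul, div_mul_cancel₀ _ hs0]
  choose X hXm hXX using hX
  have hXne : ∀ t, X t ≠ 0 := by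
    intro t h
    have := hXX t
    rw [h, zero_mul] at this
    exact (smul_ne_zero (hμ0 t) one_ne_zero) this.symm
  have hD : ∀ t x, x ∈ 𝒟 t ↔ ∃ z : ℂ, x = z • X t := by
    intro t x
    constructor
    · intro hx
      have hxx := hmul t t _ (hXm t) x hx
      rw [h2, h0] at hxx
      obtain ⟨w, hw⟩ := hxx
      refine ⟨w / μ t, ?_⟩
      have h3 : X t * (X t * x) = w • X t := by rw [hw]; simp
      rw [← mul_assoc, hXX, smul_mul_assoc, one_mul] at h3
      rw [div_eq_inv_mul, ← smul_smul, ← h3, smul_smul, inv_mul_cancel₀ (hμ0 t), one_smul]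
    · rintro ⟨z, rfl⟩
      exact hCs t _ (hXm t) z
  have hli : LinearIndependent ℂ X := by
    rw [Fintype.linearIndependent_iff]
    intro g hg t
    have := (iSupIndep_iff_finsetSum_eq_zero_imp_eq_zero 𝒟).1 hindep Finset.univ
      (fun t => g t • X t) (fun t _ => hCs t _ (hXm t) _) (by simpa using hg) t (Finset.mem_univ t)
    have h4 : g t • X t = 0 := by simpa using this
    exact (smul_eq_zero.1 h4).resolve_right (hXne t)
  have hsp : ⊤ ≤ Submodule.span ℂ (Set.range X) := by
    intro M _
    have hM : M ∈ ⨆ t, 𝒟 t := by rw [htop]; trivial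
    refine Submodule.iSup_induction 𝒟
      (motive := fun M => M ∈ Submodule.span ℂ (Set.range X)) hM ?_ ?_ ?_
    · intro s y hy
      obtain ⟨z, rfl⟩ := (hD s y).1 hy
      exact Submodule.smul_mem _ _ (Submodule.subset_span ⟨s, rfl⟩)
    · exact Submodule.zero_mem _
    · intro a b ha hb
      exact Submodule.add_mem _ ha hb
  have hc : ∀ u v, ∃ c : ℝ, X u * X v = (c : ℂ) • X (u + v) ∧ (c = 1 ∨ c = -1) := by
    intro u v
    obtain ⟨z, hz⟩ := (hD _ _).1 (hmul u v _ (hXm u) _ (hXm v))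
    have hsq : (X u * X v) * (X u * X v) = (μ (u + v) : ℂ) • (1 : Matrix (Fin n) (Fin n) ℂ) := by
      nth_rewrite 1 [hcomm u v _ (hXm u) _ (hXm v)]
      rw [hsm, smul_mul_assoc, mul_assoc, ← mul_assoc (X u) (X u), hXX, smul_mul_assoc, one_mul,
        mul_smul_comm, hXX, smul_smul, smul_smul, hμ]
      congr 1
      push_cast
      ring
    rw [hz, smul_mul_smul_comm, hXX, smul_smul] at hsq
    have h5 : z * z * (μ (u + v) : ℂ) = μ (u + v) := smul_left_injective ℂ one_ne_zero hsq
    have h6 : z * z = 1 := mul_right_cancel₀ (hμ0 (u + v)) (by rw [h5, one_mul])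
    rcases mul_self_eq_one_iff.1 h6 with h | h
    · exact ⟨1, by rw [hz, h]; simp, Or.inl rfl⟩
    · exact ⟨-1, by rw [hz, h]; simp, Or.inr rfl⟩
  choose c hc1 hc2 using hc
  refine ⟨Module.Basis.mk hli hsp, c, ?_⟩
  simp only [Module.Basis.coe_mk]
  exact ⟨hD, hXX, hc1, hc2⟩


/-- Let `T` be a finite abelian group and `β` a nondegenerate alternating
bicharacter on `T` with values in `{±1}` (i.e. `β = β̄`), and let `𝒟` be a division
grading of type (2-f) on the real algebra `M_n(ℂ)` with support `T` and commutation
bicharacter `β`.  Then the stabilizer of the grading is isomorphic to `T × ℤ₂`,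
arising as the direct product of `Hom(T, {±1}) ≅ T` and `Aut(ℂ) ≅ ℤ₂`. -/
theorem stabilizer_of_type2f_grading_beta_eq_conj
    {T : Type*} [AddCommGroup T] [Fintype T] (n : ℕ)
    (β : T → T → ℝˣ)
    (hβ₁ : ∀ u v w : T, β (u + v) w = β u w * β v w)
    (hβ₂ : ∀ u v w : T, β u (v + w) = β u v * β u w)
    (hβalt : ∀ u : T, β u u = 1)
    (hβnondeg : ∀ t : T, (∀ u : T, β u t = 1) → t = 0)
    (𝒟 : T → Submodule ℝ (Matrix (Fin n) (Fin n) ℂ))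
    (hmul : ∀ u v : T, ∀ x ∈ 𝒟 u, ∀ y ∈ 𝒟 v, x * y ∈ 𝒟 (u + v))
    (hone : (1 : Matrix (Fin n) (Fin n) ℂ) ∈ 𝒟 0)
    (hindep : iSupIndep 𝒟) (htop : (⨆ t, 𝒟 t) = ⊤)
    (hsupp : ∀ t : T, 𝒟 t ≠ ⊥)
    (hdim : ∀ t : T, Module.finrank ℝ (𝒟 t) = 2)
    (hcenter : (𝒟 0 : Set (Matrix (Fin n) (Fin n) ℂ)) =
      Set.center (Matrix (Fin n) (Fin n) ℂ))
    (hcomm : ∀ u v : T, ∀ X ∈ 𝒟 u, ∀ Y ∈ 𝒟 v,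
      X * Y = ((β u v : ℝ)) • (Y * X)) :
    (∃ Φ : (T →+ Additive ℝˣ) → (ℂ ≃ₐ[ℝ] ℂ) →
        (Matrix (Fin n) (Fin n) ℂ ≃ₐ[ℝ] Matrix (Fin n) (Fin n) ℂ),
      (∀ χ₁ σ₁ χ₂ σ₂, Φ (χ₁ + χ₂) (σ₁ * σ₂) = Φ χ₁ σ₁ * Φ χ₂ σ₂) ∧
      (∀ χ₁ σ₁ χ₂ σ₂, Φ χ₁ σ₁ = Φ χ₂ σ₂ → χ₁ = χ₂ ∧ σ₁ = σ₂) ∧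
      (∀ χ σ, ∀ t : T, ∀ x ∈ 𝒟 t, (Φ χ σ) x ∈ 𝒟 t) ∧
      (∀ ψ : Matrix (Fin n) (Fin n) ℂ ≃ₐ[ℝ] Matrix (Fin n) (Fin n) ℂ,
        (∀ t : T, ∀ x ∈ 𝒟 t, ψ x ∈ 𝒟 t) → ∃ χ σ, Φ χ σ = ψ)) ∧
    Nonempty ((T →+ Additive ℝˣ) ≃+ T) ∧
    Nonempty ((ℂ ≃ₐ[ℝ] ℂ) ≃* Multiplicative (ZMod 2)) := by
  classical
  have hβ01 : ∀ v, β 0 v = 1 := by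
    intro v; have := hβ₁ 0 0 v; simpa using this
  have hpm : ∀ u v, β u v = 1 ∨ β u v = -1 := by
    intro u v
    have h : ∀ k : ℕ, β (k • u) v = β u v ^ k := by
      intro k
      induction k with
      | zero => simp [hβ01]
      | succ k ih => rw [succ_nsmul, hβ₁, ih, pow_succ]
    have h1 := h (Fintype.card T)
    rw [card_nsmul_eq_zero, hβ01] at h1
    have h3 : |((β u v : ℝˣ) : ℝ)| ^ Fintype.card T = 1 := by
      rw [← abs_pow, ← Units.val_pow_eq_pow_val, ← h1]; simp
    rw [pow_eq_one_iff_of_nonneg (abs_nonneg _) Fintype.card_ne_zero] at h3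
    rcases (abs_eq zero_le_one).1 h3 with h4 | h4
    · left; ext; simpa using h4
    · right; ext; simpa using h4
  have h2 : ∀ t : T, t + t = 0 := by
    intro t
    apply hβnondeg
    intro u
    rw [hβ₂]
    rcases hpm u t with h | h <;> simp [h]
  obtain ⟨μ, hμ1, hμ⟩ := exists_quad h2 β hβ₁ hβ₂ hβalt hpm
  obtain ⟨b, c, hD, hbb, hc, hc1⟩ :=
    exists_X n β h2 𝒟 hmul hindep htop hsupp hcenter hcomm μ hμ1 hμ
  refine ⟨?_, dual_equiv β hβ₁ hβ₂ hβnondeg, aut_C⟩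
  have hμ00 : μ 0 = 1 := by
    have := hμ 0 0
    rw [add_zero, hβalt] at this
    rcases hμ1 0 with h | h
    · exact h
    · rw [h] at this; norm_num at this
  have he : (1 : Matrix (Fin n) (Fin n) ℂ) = (c 0 0 : ℂ) • b 0 := by
    have h3 := hc 0 0
    rw [hbb, hμ00, add_zero] at h3
    simpa using h3
  have hc00 : (c 0 0 : ℂ) * (c 0 0 : ℂ) = 1 := by
    rcases hc1 0 0 with h | h <;> simp [h]
  have hb0 : b 0 = (c 0 0 : ℂ) • 1 := by
    rw [he, smul_smul, hc00, one_smul]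
  have hμ0 : ∀ t, (μ t : ℂ) ≠ 0 := by
    intro t; rcases hμ1 t with h | h <;> simp [h]
  have hσ : ∀ (σ : ℂ ≃ₐ[ℝ] ℂ) (r : ℝ), σ (r : ℂ) = r := fun σ r => σ.commutes r
  have hinj : ∀ (t : T) (z w : ℂ), z • b t = w • b t → z = w := fun t z w h =>
    smul_left_injective ℂ (b.ne_zero t) h
  obtain ⟨Φ, hΦ⟩ := exists_Phi (fun r => rfl) b c _ hc he
  refine ⟨Φ, ?_, ?_, ?_, ?_⟩
  · intro χ₁ σ₁ χ₂ σ₂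
    ext1 x
    induction x using basis_ind b with
    | h2 x x' h h' => rw [map_add, h, h', map_add]
    | h1 z t =>
      rw [AlgEquiv.mul_apply, hΦ, hΦ, smul_smul, smul_smul, hΦ, smul_smul]
      congr 1
      simp [hσ, mul_assoc]
  · intro χ₁ σ₁ χ₂ σ₂ h
    constructor
    · ext t
      have h3 : Φ χ₁ σ₁ ((1 : ℂ) • b t) = Φ χ₂ σ₂ ((1 : ℂ) • b t) := by rw [h]
      rw [hΦ, hΦ, map_one, map_one, one_smul] at h3
      have h4 := hinj _ _ _ h3
      exact_mod_cast h4
    · ext z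
      have h3 : Φ χ₁ σ₁ (z • b 0) = Φ χ₂ σ₂ (z • b 0) := by rw [h]
      rw [hΦ, hΦ] at h3
      simp only [map_zero, toMul_zero, Units.val_one, Complex.ofReal_one, one_smul] at h3
      exact hinj _ _ _ h3
  · intro χ σ t x hx
    obtain ⟨z, rfl⟩ := (hD t x).1 hx
    rw [hΦ, smul_smul]
    exact (hD _ _).2 ⟨_, rfl⟩
  · intro ψ hψ
    have hz : ∀ z : ℂ, ∃ w : ℂ, ψ (z • 1) = w • 1 := by
      intro z
      have : z • (1 : Matrix (Fin n) (Fin n) ℂ) ∈ 𝒟 0 := (hD _ _).2 ⟨_, by rw [he, smul_smul]⟩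
      obtain ⟨w, hw⟩ := (hD _ _).1 (hψ 0 _ this)
      exact ⟨_, by rw [hw, hb0, smul_smul]⟩
    choose s hs using hz
    have h1ne : (1 : Matrix (Fin n) (Fin n) ℂ) ≠ 0 := by
      intro h
      apply b.ne_zero 0
      rw [hb0, h, smul_zero]
    have hinj1 : ∀ z w : ℂ, z • (1 : Matrix (Fin n) (Fin n) ℂ) = w • 1 → z = w := fun z w h =>
      smul_left_injective ℂ h1ne h
    have hsr : ∀ r : ℝ, s (r : ℂ) = r := by
      intro r
      apply hinj1
      rw [← hs]
      have := ψ.commutes r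
      rw [Algebra.algebraMap_eq_smul_one] at this
      rw [← smul_one_smul ℂ r (1 : Matrix (Fin n) (Fin n) ℂ)] at this
      simpa using this
    let s1 : ℂ →ₐ[ℝ] ℂ :=
      { toFun := s
        map_one' := by simpa using hsr 1
        map_zero' := by simpa using hsr 0
        map_add' := fun z w => hinj1 _ _ (by rw [← hs, add_smul, map_add, hs, hs, add_smul])
        map_mul' := fun z w => hinj1 _ _ (by
          rw [← hs, ← one_mul (1 : Matrix (Fin n) (Fin n) ℂ), ← smul_mul_smul_comm, map_mul, hs, hs,
            smul_mul_smul_comm])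
        commutes' := hsr }
    let σ : ℂ ≃ₐ[ℝ] ℂ := AlgEquiv.ofBijective s1 (Algebra.IsAlgebraic.algHom_bijective s1)
    have hσs : ∀ z, σ z = s z := fun z => rfl
    have ha : ∀ t, ∃ a : ℝˣ, ψ (b t) = (((a : ℝˣ) : ℝ) : ℂ) • b t := by
      intro t
      obtain ⟨a, ha⟩ := (hD _ _).1 (hψ t (b t) ((hD _ _).2 ⟨1, by simp⟩))
      have h3 := congrArg ψ (hbb t)
      rw [hs, hsr, map_mul, ha, smul_mul_smul_comm, hbb, smul_smul] at h3
      have h4 := hinj1 _ _ h3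
      have h6 : a * a = 1 := mul_right_cancel₀ (hμ0 t) (by rw [h4, one_mul])
      rcases mul_self_eq_one_iff.1 h6 with h | h
      · exact ⟨1, by rw [ha, h]; simp⟩
      · exact ⟨-1, by rw [ha, h]; simp⟩
    choose a ha using ha
    have hψz : ∀ (z : ℂ) t, ψ (z • b t) = (((a t : ℝˣ) : ℝ) : ℂ) • s z • b t := by
      intro z t
      have : z • b t = (z • 1) * b t := by simp
      rw [this, map_mul, hs, ha, smul_mul_smul_comm, one_mul, smul_smul, mul_comm]
    have hcne : ∀ u v, (c u v : ℂ) ≠ 0 := by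
      intro u v; rcases hc1 u v with h | h <;> simp [h]
    refine ⟨AddMonoidHom.mk' (fun t => Additive.ofMul (a t)) ?_, σ, ?_⟩
    · intro u v
      have h3 := congrArg ψ (hc u v)
      rw [map_mul, ha, ha, smul_mul_smul_comm, hc, hψz, hsr, smul_smul, smul_smul] at h3
      have h4 := mul_right_cancel₀ (hcne u v) (hinj _ _ _ h3)
      have h5 : a (u + v) = a u * a v := by
        ext
        exact_mod_cast h4.symm
      rw [h5]; rfl
    · ext1 x
      induction x using basis_ind b with
      | h2 x x' h h' => rw [map_add, h, h', map_add]
      | h1 z t =>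
        rw [hΦ, hψz]
        rfl
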